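/- Let k be a field, m ≥ n ≥ 1, and let v ∈ k^{mn−1} be a row vector. Write (1,v) ∈ k^{mn} as (a_1,…,a_m) with each a_i ∈ k^n, and let R(v) ∈ M_{m×n}(k) be the matrix with rows a_1,…,a_m. Set r := rank(R(v)) − 1. Then 0 ≤ r ≤ n−1 and the double cosets coincide: P_{mn−1,1}(k)·w_1·u_1(v)·T_{m,n}(k) = P_{mn−1,1}(k)·ε_r·T_{m,n}(k). -/

import Mathlib

open Matrix

/-- Kronecker product of square matrices, realized on `Fin (m * n)`:
the `(i,j)` block of size `n` is `h i j • g`. -/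
def kron {k : Type*} [Field k] {m n : ℕ} (h : Matrix (Fin m) (Fin m) k)
    (g : Matrix (Fin n) (Fin n) k) : Matrix (Fin (m * n)) (Fin (m * n)) k :=
  Matrix.of fun x y => h x.divNat y.divNat * g x.modNat y.modNat

/-- `T_{m,n}(k)`: the image of the Kronecker product map on invertible matrices. -/
def TSet (k : Type*) [Field k] (m n : ℕ) : Set (Matrix (Fin (m * n)) (Fin (m * n)) k) :=
  {A | ∃ (h : Matrix (Fin m) (Fin m) k) (g : Matrix (Fin n) (Fin n) k),
    IsUnit h.det ∧ IsUnit g.det ∧ A = kron h g}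

/-- `P_{N-1,1}(k)`: invertible `N × N` matrices whose last row is `(0,…,0,d)`, `d ≠ 0`. -/
def ParabP (k : Type*) [Field k] (N : ℕ) : Set (Matrix (Fin N) (Fin N) k) :=
  {A | IsUnit A.det ∧ ∀ i j : Fin N, (i : ℕ) = N - 1 → (j : ℕ) ≠ N - 1 → A i j = 0}

/-- The permutation matrix `w_j` (with `1 ≤ j ≤ N`), given in block form by rows
`((I_{j−1},0,0),(0,0,I_{N−j}),(0,1,0))`, the middle column block having width 1. -/
def wMat (k : Type*) [Field k] (N j : ℕ) : Matrix (Fin N) (Fin N) k :=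
  Matrix.of fun i l =>
    if (l : ℕ) = (if (i : ℕ) + 1 < j then (i : ℕ)
                  else if (i : ℕ) + 1 < N then (i : ℕ) + 1 else j - 1)
    then 1 else 0

/-- The unipotent matrix `u_j(v)` (with `1 ≤ j ≤ N`, `v` a row vector of length `N - j`):
the identity except that its `j`-th row is `(0,…,0,1,v)` with the `1` in position `j`. -/
def uMat (k : Type*) [Field k] (N j : ℕ) (v : Fin (N - j) → k) : Matrix (Fin N) (Fin N) k :=
  Matrix.of fun i l =>
    if (i : ℕ) = j - 1 then
      (if (l : ℕ) = j - 1 then 1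
       else if h : j ≤ (l : ℕ) then v ⟨(l : ℕ) - j, by have := l.isLt; omega⟩ else 0)
    else if l = i then 1 else 0

/-- The row vector `b_r ∈ k^{rn}` given by concatenating the standard basis row vectors
`e_{n-1}, e_{n-2}, …, e_{n-r}` of `k^n`: its block `p` (0-based) is `e_{n-1-p}`. -/
def bVec (k : Type*) [Field k] (n : ℕ) {M : ℕ} : Fin M → k :=
  fun i => if (i : ℕ) % n + (i : ℕ) / n + 2 = n then 1 else 0

/-- The representative `ε_r := w_{(m−r)n} · u_{(m−r)n}(b_r) ∈ GL_{mn}(k)`. -/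
def epsMat (k : Type*) [Field k] (m n r : ℕ) : Matrix (Fin (m * n)) (Fin (m * n)) k :=
  wMat k (m * n) ((m - r) * n) * uMat k (m * n) ((m - r) * n) (bVec k n)

/-- The double coset `P_{mn−1,1}(k) · A · T_{m,n}(k)`. -/
def dCoset (k : Type*) [Field k] (m n : ℕ) (A : Matrix (Fin (m * n)) (Fin (m * n)) k) :
    Set (Matrix (Fin (m * n)) (Fin (m * n)) k) :=
  {X | ∃ p ∈ ParabP k (m * n), ∃ t ∈ TSet k m n, X = p * A * t}

open Module in
/-- Two linear maps with the same rank differ by automorphisms of the source and the target. -/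
theorem LinearMap.exists_linearEquiv_comp_eq_comp {K V W : Type*} [Field K]
    [AddCommGroup V] [Module K V] [FiniteDimensional K V]
    [AddCommGroup W] [Module K W] [FiniteDimensional K W] (f g : V →ₗ[K] W)
    (h : finrank K (LinearMap.range f) = finrank K (LinearMap.range g)) :
    ∃ (a : V ≃ₗ[K] V) (b : W ≃ₗ[K] W), ∀ x, g (a x) = b (f x) := by
  have φ := LinearEquiv.ofFinrankEq _ _ h
  obtain ⟨b, hb⟩ := Submodule.exists_linearEquiv_restrict_eq φ
  obtain ⟨C, hC⟩ := Submodule.exists_isCompl (LinearMap.ker f)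
  obtain ⟨D, hD⟩ := Submodule.exists_isCompl (LinearMap.ker g)
  have hker : finrank K (LinearMap.ker f) = finrank K (LinearMap.ker g) := by
    have h₁ := f.finrank_range_add_finrank_ker
    have h₂ := g.finrank_range_add_finrank_ker
    omega
  have β := LinearEquiv.ofFinrankEq _ _ hker
  let α : C ≃ₗ[K] D :=
    f.kerComplementEquivRange hC.symm ≪≫ₗ φ ≪≫ₗ (g.kerComplementEquivRange hD.symm).symm
  have hα (x : C) : g (α x) = b (f x) := by
    have h₁ : g.kerComplementEquivRange hD.symm (α x) =
        φ (f.kerComplementEquivRange hC.symm x) := by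
      simp only [α, LinearEquiv.trans_apply, LinearEquiv.apply_symm_apply]
    have h₂ := congrArg Subtype.val h₁
    rw [hb] at h₂
    exact h₂
  let eC := Submodule.prodEquivOfIsCompl _ _ hC
  let eD := Submodule.prodEquivOfIsCompl _ _ hD
  refine ⟨eC.symm ≪≫ₗ LinearEquiv.prodCongr β α ≪≫ₗ eD, b, fun x => ?_⟩
  obtain ⟨⟨y, z⟩, rfl⟩ := eC.surjective x
  have hy : f y = 0 := y.2
  have hβ : g (β y) = 0 := (β y).2
  simp [eC, eD, hy, hβ, hα]

/-- Two matrices of the same size and rank over a field are equivalent. -/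
theorem Matrix.exists_mul_mul_eq_of_rank_eq {K : Type*} [Field K] {m n : Type*}
    [Fintype m] [DecidableEq m] [Fintype n] [DecidableEq n] (A B : Matrix m n K)
    (h : A.rank = B.rank) :
    ∃ (P : Matrix m m K) (Q : Matrix n n K), IsUnit P.det ∧ IsUnit Q.det ∧ P * A * Q = B := by
  obtain ⟨a, b, hab⟩ := LinearMap.exists_linearEquiv_comp_eq_comp A.mulVecLin B.mulVecLin h
  refine ⟨LinearMap.toMatrix' b.toLinearMap, LinearMap.toMatrix' a.symm.toLinearMap, ?_, ?_, ?_⟩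
  · rw [LinearMap.det_toMatrix']
    exact b.isUnit_det'
  · rw [LinearMap.det_toMatrix']
    exact a.symm.isUnit_det'
  · apply Matrix.toLin'.injective
    ext1 x
    ext1
    have := hab (a.symm (Pi.single x 1))
    simp only [LinearEquiv.apply_symm_apply, Matrix.mulVecLin_apply] at this
    simp [Matrix.toLin'_mul, this]

theorem Fin.divNat_finProdFinEquiv {m n : ℕ} (x : Fin m × Fin n) :
    (finProdFinEquiv x).divNat = x.1 :=
  congrArg Prod.fst (finProdFinEquiv.symm_apply_apply x)

theorem Fin.modNat_finProdFinEquiv {m n : ℕ} (x : Fin m × Fin n) :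
    (finProdFinEquiv x).modNat = x.2 :=
  congrArg Prod.snd (finProdFinEquiv.symm_apply_apply x)

section

variable {k : Type*} [Field k] {m n : ℕ}

theorem kron_eq_reindex (h : Matrix (Fin m) (Fin m) k) (g : Matrix (Fin n) (Fin n) k) :
    kron h g = Matrix.reindex finProdFinEquiv finProdFinEquiv (Matrix.kronecker h g) := rfl

theorem kron_mul_kron (h h' : Matrix (Fin m) (Fin m) k) (g g' : Matrix (Fin n) (Fin n) k) :
    kron h g * kron h' g' = kron (h * h') (g * g') := by
  simp [kron_eq_reindex, Matrix.mul_kronecker_mul, Matrix.submatrix_mul_equiv]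

theorem isUnit_det_kron {h : Matrix (Fin m) (Fin m) k} {g : Matrix (Fin n) (Fin n) k}
    (hh : IsUnit h.det) (hg : IsUnit g.det) : IsUnit (kron h g).det := by
  rw [kron_eq_reindex, Matrix.det_reindex_self, Matrix.kronecker, Matrix.det_kronecker]
  exact (hh.pow _).mul (hg.pow _)

/-- Reading a row vector of length `m * n` as an `m × n` matrix turns right multiplication by
`kron h g` into `X ↦ hᵀ * X * g`. -/
theorem vecMul_kron (c : Fin (m * n) → k) (h : Matrix (Fin m) (Fin m) k)
    (g : Matrix (Fin n) (Fin n) k) (i : Fin m) (j : Fin n) :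
    (c ᵥ* kron h g) (finProdFinEquiv (i, j)) =
      (hᵀ * Matrix.of (fun i j => c (finProdFinEquiv (i, j))) * g) i j := by
  simp only [Matrix.vecMul, dotProduct, Matrix.mul_apply, Matrix.transpose_apply, Matrix.of_apply,
    ← Equiv.sum_comp finProdFinEquiv, Fintype.sum_prod_type, kron, Fin.divNat_finProdFinEquiv,
    Fin.modNat_finProdFinEquiv, Finset.sum_mul]
  rw [Finset.sum_comm]
  exact Finset.sum_congr rfl fun _ _ => Finset.sum_congr rfl fun _ _ => by ring

theorem mul_mem_TSet {s t : Matrix (Fin (m * n)) (Fin (m * n)) k}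
    (hs : s ∈ TSet k m n) (ht : t ∈ TSet k m n) : s * t ∈ TSet k m n := by
  obtain ⟨h, g, hh, hg, rfl⟩ := hs
  obtain ⟨h', g', hh', hg', rfl⟩ := ht
  refine ⟨h * h', g * g', ?_, ?_, kron_mul_kron ..⟩
  · exact Matrix.det_mul h h' ▸ hh.mul hh'
  · exact Matrix.det_mul g g' ▸ hg.mul hg'

theorem mul_mem_ParabP {N : ℕ} {p q : Matrix (Fin N) (Fin N) k}
    (hp : p ∈ ParabP k N) (hq : q ∈ ParabP k N) : p * q ∈ ParabP k N := by
  refine ⟨Matrix.det_mul p q ▸ hp.1.mul hq.1, fun i j hi hj => ?_⟩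
  rw [Matrix.mul_apply]
  refine Finset.sum_eq_zero fun l _ => ?_
  by_cases hl : (l : ℕ) = N - 1
  · rw [hq.2 l j hl hj, mul_zero]
  · rw [hp.2 i l hi hl, zero_mul]

/-- The double coset of an invertible matrix only depends on the `T`-orbit of its last row. -/
theorem dCoset_subset_of_vecMul_eq {A B : Matrix (Fin (m * n)) (Fin (m * n)) k}
    (hA : IsUnit A.det) (hB : IsUnit B.det) {t : Matrix (Fin (m * n)) (Fin (m * n)) k}
    (ht : t ∈ TSet k m n) (i : Fin (m * n)) (hi : (i : ℕ) = m * n - 1)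
    (h : A i ᵥ* t = B i) : dCoset k m n B ⊆ dCoset k m n A := by
  have hAt : IsUnit (A * t).det := by
    obtain ⟨x, y, hx, hy, rfl⟩ := ht
    rw [Matrix.det_mul]
    exact hA.mul (isUnit_det_kron hx hy)
  have hp : B * (A * t)⁻¹ ∈ ParabP k (m * n) := by
    refine ⟨?_, fun i' j hi' hj => ?_⟩
    · rw [Matrix.det_mul]
      exact hB.mul (Matrix.isUnit_nonsing_inv_det _ hAt)
    · obtain rfl : i' = i := Fin.ext (hi'.trans hi.symm)
      have hrow : (B * (A * t)⁻¹) i' = (1 : Matrix (Fin (m * n)) (Fin (m * n)) k) i' := by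
        rw [← Matrix.mul_nonsing_inv _ hAt, Matrix.mul_apply_eq_vecMul, ← h,
          ← Matrix.mul_apply_eq_vecMul A, ← Matrix.mul_apply_eq_vecMul]
      rw [hrow, Matrix.one_apply_ne]
      rintro rfl
      exact hj hi
  rintro _ ⟨p', hp', t', ht', rfl⟩
  refine ⟨p' * (B * (A * t)⁻¹), mul_mem_ParabP hp' hp, t * t', mul_mem_TSet ht ht', ?_⟩
  calc p' * B * t' = p' * (B * ((A * t)⁻¹ * (A * t))) * t' := by
        rw [Matrix.nonsing_inv_mul _ hAt, mul_one]
    _ = _ := by simp only [mul_assoc]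

/-- Two invertible matrices whose last rows, read as `m × n` matrices, have the same rank lie in
the same double coset. -/
theorem dCoset_subset_of_rank_eq {A B : Matrix (Fin (m * n)) (Fin (m * n)) k}
    (hA : IsUnit A.det) (hB : IsUnit B.det) (i : Fin (m * n)) (hi : (i : ℕ) = m * n - 1)
    (h : (Matrix.of fun x y => A i (finProdFinEquiv (x, y))).rank =
      (Matrix.of fun x y => B i (finProdFinEquiv (x, y))).rank) :
    dCoset k m n B ⊆ dCoset k m n A := by
  obtain ⟨P, Q, hP, hQ, hPQ⟩ := Matrix.exists_mul_mul_eq_of_rank_eq _ _ h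
  refine dCoset_subset_of_vecMul_eq hA hB
    ⟨Pᵀ, Q, by rwa [Matrix.det_transpose], hQ, rfl⟩ i hi ?_
  ext l
  obtain ⟨⟨x, y⟩, rfl⟩ := finProdFinEquiv.surjective l
  rw [vecMul_kron, Matrix.transpose_transpose, hPQ, Matrix.of_apply]

theorem isUnit_det_wMat {N j : ℕ} (hj : 1 ≤ j) : IsUnit (wMat k N j).det := by
  refine Matrix.isUnit_det_of_right_inverse (B := (wMat k N j)ᵀ) ?_
  ext i i'
  let s : Fin N := ⟨if (i : ℕ) + 1 < j then (i : ℕ)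
    else if (i : ℕ) + 1 < N then (i : ℕ) + 1 else j - 1, by split_ifs <;> omega⟩
  rw [Matrix.mul_apply, Finset.sum_eq_single s]
  · simp only [wMat, Matrix.transpose_apply, Matrix.of_apply, Matrix.one_apply, s, Fin.ext_iff]
    grind
  · intro l _ hl
    rw [wMat, Matrix.of_apply, if_neg fun e => hl (Fin.ext e), zero_mul]
  · simp

theorem isUnit_det_uMat {N j : ℕ} (v : Fin (N - j) → k) : IsUnit (uMat k N j v).det := by
  rw [Matrix.det_of_isUpperTriangular]
  · rw [Finset.prod_eq_one]
    · exact isUnit_one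
    · intro i _
      simp only [uMat, Matrix.of_apply]
      split_ifs <;> rfl
  · intro i l hl
    have hl' : (l : ℕ) < i := hl
    simp only [uMat, Matrix.of_apply, Fin.ext_iff]
    grind

theorem isUnit_det_wMat_mul_uMat {N j : ℕ} (hj : 1 ≤ j) (v : Fin (N - j) → k) :
    IsUnit (wMat k N j * uMat k N j v).det := by
  rw [Matrix.det_mul]
  exact (isUnit_det_wMat hj).mul (isUnit_det_uMat v)

/-- The last row of `w_j * u_j(v)` is the `j`-th row of `u_j(v)`. -/
theorem wMat_mul_uMat_last {N j : ℕ} (hj : 1 ≤ j) (hjN : j ≤ N) (v : Fin (N - j) → k)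
    (i l : Fin N) (hi : (i : ℕ) = N - 1) :
    (wMat k N j * uMat k N j v) i l =
      if (l : ℕ) = j - 1 then 1
      else if h : j ≤ (l : ℕ) then v ⟨(l : ℕ) - j, by have := l.isLt; omega⟩ else 0 := by
  have hσ : (if (i : ℕ) + 1 < j then (i : ℕ)
      else if (i : ℕ) + 1 < N then (i : ℕ) + 1 else j - 1) = j - 1 := by
    rw [if_neg (by omega), if_neg (by omega)]
  rw [Matrix.mul_apply, Finset.sum_eq_single (⟨j - 1, by omega⟩ : Fin N)]
  · simp [wMat, uMat, hσ]
  · intro x _ hx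
    rw [wMat, Matrix.of_apply, hσ, if_neg fun e => hx (Fin.ext e), zero_mul]
  · simp

/-- The last row of `ε_r`, read as an `m × n` matrix, has ones on the antidiagonal ending in the
last column of row `m - r` and zeros elsewhere. -/
theorem epsMat_last {r : ℕ} (hrn : r < n) (hrm : r < m) (i : Fin (m * n))
    (hi : (i : ℕ) = m * n - 1) (x : Fin m) (y : Fin n) :
    epsMat k m n r i (finProdFinEquiv (x, y)) =
      if (x : ℕ) + y + r + 2 = m + n then 1 else 0 := by
  obtain ⟨d, rfl⟩ : ∃ d, m = d + 1 + r := ⟨m - r - 1, by omega⟩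
  have hd : d + 1 + r - r = d + 1 := by omega
  have hle : (d + 1) * n ≤ (d + 1 + r) * n := Nat.mul_le_mul_right _ (by omega)
  have hx := x.isLt
  have hy := y.isLt
  rw [epsMat, hd, wMat_mul_uMat_last (by rw [add_mul]; omega) hle _ _ _ hi]
  simp only [finProdFinEquiv_apply_val, bVec]
  have hsucc : (d + 1) * n = n * d + n := by ring
  rw [hsucc]
  rcases lt_trichotomy (x : ℕ) d with h | h | h
  · have : n * x + n ≤ n * d := by
      calc n * x + n = n * (x + 1) := by ring
        _ ≤ n * d := Nat.mul_le_mul_left _ h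
    rw [if_neg (by omega), dif_neg (by omega), if_neg (by omega)]
  · rw [h, dif_neg (by omega)]
    grind
  · obtain ⟨q, hq⟩ : ∃ q, (x : ℕ) = d + 1 + q := ⟨x - (d + 1), by omega⟩
    have hmul : n * (x : ℕ) = n * d + n + n * q := by rw [hq]; ring
    have hsub : (y : ℕ) + n * x - (n * d + n) = y + n * q := by omega
    rw [if_neg (by omega), dif_pos (by omega), hsub, Nat.add_mul_mod_self_left,
      Nat.mod_eq_of_lt hy, Nat.add_mul_div_left _ _ (by omega), Nat.div_eq_of_lt hy, hq]
    congr 1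
    apply propext
    omega

theorem rank_antidiagonal {r : ℕ} (hrn : r < n) (hrm : r < m) :
    (Matrix.of fun (x : Fin m) (y : Fin n) =>
      if (x : ℕ) + y + r + 2 = m + n then (1 : k) else 0).rank = r + 1 := by
  apply le_antisymm
  · refine (Matrix.rank_le_card_of_support_subset _
      (Finset.univ.image fun a : Fin (r + 1) => (⟨m - 1 - a, by omega⟩ : Fin m)) ?_).trans
      (Finset.card_image_le.trans (by simp))
    intro x hx
    obtain ⟨y, hy⟩ := Function.ne_iff.mp hx
    have hy' : (x : ℕ) + y + r + 2 = m + n := by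
      by_contra hne
      exact hy (if_neg hne)
    simp only [Finset.coe_image, Finset.coe_univ, Set.image_univ, Set.mem_range]
    exact ⟨⟨m - 1 - x, by omega⟩, Fin.ext (by simp; omega)⟩
  · have h := Matrix.rank_submatrix_le (Matrix.of fun (x : Fin m) (y : Fin n) =>
      if (x : ℕ) + y + r + 2 = m + n then (1 : k) else 0)
      (fun a : Fin (r + 1) => ⟨m - 1 - a, by omega⟩)
      (fun a : Fin (r + 1) => ⟨n - 1 - (r - a), by omega⟩)
    have hone : (Matrix.of fun (x : Fin m) (y : Fin n) =>
        if (x : ℕ) + y + r + 2 = m + n then (1 : k) else 0).submatrix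
        (fun a : Fin (r + 1) => ⟨m - 1 - a, by omega⟩)
        (fun a : Fin (r + 1) => ⟨n - 1 - (r - a), by omega⟩) = 1 := by
      ext a b
      simp only [Matrix.submatrix_apply, Matrix.of_apply, Matrix.one_apply, Fin.ext_iff]
      congr 1
      apply propext
      omega
    rwa [hone, Matrix.rank_one, Fintype.card_fin] at h

end

/-- Write `(1,v) ∈ k^{mn}` as `(a_1,…,a_m)` with `a_i ∈ k^n` and let `R(v) ∈ M_{m×n}(k)` have
rows `a_1,…,a_m`; set `r := rank R(v) − 1`. Then `0 ≤ r ≤ n−1` and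
`P_{mn−1,1}(k)·w_1·u_1(v)·T_{m,n}(k) = P_{mn−1,1}(k)·ε_r·T_{m,n}(k)`. -/
theorem statement5 (k : Type*) [Field k] (m n : ℕ) (hn : 1 ≤ n) (hnm : n ≤ m)
    (v : Fin (m * n - 1) → k)
    (c : Fin (m * n) → k)
    (hc : ∀ l : Fin (m * n), c l =
      if h : (l : ℕ) = 0 then 1
      else v ⟨(l : ℕ) - 1, by have := l.isLt; omega⟩)
    (R : Matrix (Fin m) (Fin n) k)
    (hR : ∀ (i : Fin m) (j : Fin n), R i j = c (finProdFinEquiv (i, j))) :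
    R.rank - 1 ≤ n - 1 ∧
      dCoset k m n (wMat k (m * n) 1 * uMat k (m * n) 1 v) =
        dCoset k m n (epsMat k m n (R.rank - 1)) := by
  have hN : 1 ≤ m * n := Nat.mul_pos (by omega) hn
  have hrank : R.rank ≠ 0 := by
    intro h0
    have hz : R ⟨0, by omega⟩ ⟨0, hn⟩ = 0 := by
      rw [Matrix.rank, Submodule.finrank_eq_zero, LinearMap.range_eq_bot] at h0
      have := congrFun (LinearMap.congr_fun h0 (Pi.single ⟨0, hn⟩ 1)) ⟨0, by omega⟩
      simpa using this
    rw [hR, hc] at hz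
    simp at hz
  have hle : R.rank ≤ n := R.rank_le_width
  refine ⟨by omega, ?_⟩
  obtain ⟨r, hr⟩ : ∃ r, R.rank = r + 1 := ⟨R.rank - 1, by omega⟩
  rw [hr, Nat.add_sub_cancel]
  have hrn : r < n := by omega
  have hrm : r < m := by omega
  let i : Fin (m * n) := ⟨m * n - 1, by omega⟩
  have hA : IsUnit (wMat k (m * n) 1 * uMat k (m * n) 1 v).det :=
    isUnit_det_wMat_mul_uMat le_rfl v
  have hB : IsUnit (epsMat k m n r).det :=
    isUnit_det_wMat_mul_uMat (Nat.mul_pos (by omega) hn) _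
  have hRA : (Matrix.of fun x y =>
      (wMat k (m * n) 1 * uMat k (m * n) 1 v) i (finProdFinEquiv (x, y))) = R := by
    ext x y
    rw [Matrix.of_apply, hR, hc, wMat_mul_uMat_last le_rfl hN v i _ rfl]
    grind
  have hRB : (Matrix.of fun x y => epsMat k m n r i (finProdFinEquiv (x, y))).rank = r + 1 := by
    rw [← rank_antidiagonal (k := k) hrn hrm]
    congr 1
    ext x y
    exact epsMat_last hrn hrm i rfl x y
  have h := (congrArg Matrix.rank hRA).trans (hr.trans hRB.symm)
  exact (dCoset_subset_of_rank_eq hB hA i rfl h.symm).antisymm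
    (dCoset_subset_of_rank_eq hA hB i rfl h)
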